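/- Carlitz's ${}_5\phi_4$ summation: for a nonnegative integer n with m = ⌊n/2⌋, and parameters b, c, d, e satisfying b·c·d·e = q^{1+m-2n}, the terminating sum ∑_{k=0}^{n} [(q^{-n};q)_k (b;q)_k (c;q)_k (d;q)_k (e;q)_k / ((q;q)_k (q^{-n+1}/b;q)_k (q^{-n+1}/c;q)_k (q^{-n+1}/d;q)_k (q^{-n+1}/e;q)_k)] q^k equals q^{m(1+m-n)} (de)^{-m} · (q^{-n};q)_{2m} (q^{-n+1}/bc;q)_m (q^{-n+1}/bd;q)_m (q^{-n+1}/be;q)_m (q^{2m-n};q)_{n-2m} / [(q;q)_m (q^{-n+1}/b;q)_m (q^{-n+1}/d;q)_m (q^{-n+1}/e;q)_m (q^{n-m} c;q)_m]. -/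

import Mathlib

open Finset

noncomputable def qp (q a : ℂ) (n : ℕ) : ℂ := ∏ j ∈ Finset.range n, (1 - a * q ^ j)

noncomputable def qpZ (q a : ℂ) (k : ℤ) : ℂ :=
  if 0 ≤ k then qp q a k.toNat else 1 / qp q (a * q ^ k) (-k).toNat

noncomputable def qpInf (q a : ℂ) : ℂ := ∏' j : ℕ, (1 - a * q ^ j)


lemma qp_zero (q a : ℂ) : qp q a 0 = 1 := by simp [qp]

lemma qp_succ (q a : ℂ) (k : ℕ) : qp q a (k+1) = qp q a k * (1 - a * q ^ k) := by
  simp [qp, Finset.prod_range_succ]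

lemma qp_succ' (q a : ℂ) (k : ℕ) : qp q a (k+1) = (1 - a) * qp q (a * q) k := by
  simp only [qp, Finset.prod_range_succ']
  rw [mul_comm]; simp only [pow_zero, mul_one]
  congr 1
  apply Finset.prod_congr rfl; intros; ring

lemma qp_shift (q a : ℂ) (k : ℕ) : (1 - a) * qp q (a * q) k = qp q a k * (1 - a * q ^ k) := by
  rw [← qp_succ, qp_succ']

lemma qp_add (q a : ℂ) (k l : ℕ) : qp q a (k+l) = qp q a k * qp q (a * q ^ k) l := by
  simp only [qp, Finset.prod_range_add]
  congr 1
  apply Finset.prod_congr rfl; intros; ring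

lemma qp_ne {q a : ℂ} {k : ℕ} : qp q a k ≠ 0 ↔ ∀ j < k, 1 - a * q ^ j ≠ 0 := by
  simp [qp, Finset.prod_ne_zero_iff]

/-- balanced part of the Jackson summand, without the `a`-factors -/
noncomputable def jw (q a b c d e : ℂ) (N k : ℕ) : ℂ :=
  qp q b k * qp q c k * qp q d k * qp q e k * qp q ((q ^ N)⁻¹) k * q ^ k /
   (qp q q k * qp q (a * q / b) k * qp q (a * q / c) k * qp q (a * q / d) k * qp q (a * q / e) k)

noncomputable def jy (q a : ℂ) (N k : ℕ) : ℂ :=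
  qp q a k * (1 - a * q ^ (2 * k)) / ((1 - a) * qp q (a * q ^ (N + 1)) k)

noncomputable def jl (q a : ℂ) (N : ℕ) : ℂ :=
  qp q (a * q) (N - 1) / qp q (a * q ^ (N + 1)) (N - 1)

noncomputable def jr (q a b c d : ℂ) (N : ℕ) : ℂ :=
  qp q (a * q) N * qp q (a * q / (b * c)) N * qp q (a * q / (b * d)) N * qp q (a * q / (c * d)) N /
   (qp q (a * q / b) N * qp q (a * q / c) N * qp q (a * q / d) N * qp q (a * q / (b * c * d)) N)

noncomputable def jK (q a b c d e : ℂ) (N : ℕ) : ℂ :=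
  q * ((1 - b) / (1 - a * q / b)) * ((1 - c) / (1 - a * q / c)) * ((1 - d) / (1 - a * q / d)) *
   ((1 - a * q) * (1 - a * q ^ 2) * ((e - 1 / q ^ (N+1)) * (1 - a * q ^ (N+1) / e)) /
   ((1 - a / e) * (1 - a * q / e) * (1 - a * q ^ (N + 1)) * (1 - a * q ^ (N + 2))))

/-- the ratio for one pair of parameters -/
lemma pair_step (q a b : ℂ) (hq : q ≠ 0) (k : ℕ) :
    qp q b (k+1) / qp q (a * q / b) (k+1) =
     (1 - b) / (1 - a * q / b) * (qp q (b * q) k / qp q (a * q ^ 2 * q / (b * q)) k) := by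
  rw [qp_succ', qp_succ', show a * q ^ 2 * q / (b * q) = a * q / b * q by field_simp, mul_div_mul_comm]

lemma e_step1 (q a e : ℂ) (hq : q ≠ 0) (he : e ≠ 0) (k : ℕ)
    (h : 1 - a * q / e * q ^ k ≠ 0) (h0 : 1 - a * q / e ≠ 0) :
    qp q (e * q) (k+1) / qp q (a * q / (e * q)) (k+1) =
     (1 - e * q ^ (k+1)) * (1 - a * q ^ (k+1) / e) / ((1 - a / e) * (1 - a * q / e)) *
      (qp q (e * q) k / qp q (a * q ^ 2 * q / (e * q)) k) := by
  have h1 := qp_shift q (a * q / e) k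
  have h2 : qp q (a * q / e) k = (1 - a * q / e) * qp q (a * q / e * q) k / (1 - a * q / e * q ^ k) := by
    rw [h1, mul_div_cancel_right₀ _ h]
  rw [qp_succ, qp_succ', show a * q ^ 2 * q / (e * q) = a * q / e * q by field_simp,
    show a * q / (e * q) = a / e by field_simp, show a / e * q = a * q / e by ring, h2,
    show a * q ^ (k+1) / e = a * q / e * q ^ k by ring,
    show e * q ^ (k+1) = e * q * q ^ k by ring]
  generalize qp q (a * q / e * q) k = X
  by_cases hX : X = 0
  · simp [hX]
  by_cases ha : 1 - a / e = 0
  · simp [ha]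
  generalize 1 - a * q / e * q ^ k = Y at *
  generalize 1 - a * q / e = Z at *
  generalize 1 - a / e = Z at *
  field_simp

lemma n_step (q : ℂ) (hq : q ≠ 0) (N k : ℕ) : qp q ((q ^ (N+1))⁻¹) (k+1) =
    (1 - 1 / q ^ (N+1)) * qp q ((q ^ N)⁻¹) k := by
  rw [qp_succ']
  congr 1
  · simp
  · congr 1; field_simp; ring

lemma jw_step1 (q a b c d e : ℂ) (hq : q ≠ 0) (he : e ≠ 0) (N k : ℕ)
    (h : 1 - a * q / e * q ^ k ≠ 0) (h0 : 1 - a * q / e ≠ 0) :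
    jw q a b c d (e * q) (N+1) (k+1) =
      jw q (a * q ^ 2) (b * q) (c * q) (d * q) (e * q) N k *
      (q * ((1 - b) / (1 - a * q / b)) * ((1 - c) / (1 - a * q / c)) * ((1 - d) / (1 - a * q / d)) *
       ((1 - e * q ^ (k+1)) * (1 - a * q ^ (k+1) / e) / ((1 - a / e) * (1 - a * q / e))) *
       ((1 - 1 / q ^ (N+1)) / (1 - q ^ (k+1)))) := by
  have e1 : ∀ a b c d e N k, jw q a b c d e N k = (qp q b k / qp q (a * q / b) k) * (qp q c k / qp q (a * q / c) k)
     * (qp q d k / qp q (a * q / d) k) * (qp q e k / qp q (a * q / e) k) * (qp q ((q ^ N)⁻¹) k * q ^ k / qp q q k) := by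
    intros; unfold jw; ring
  rw [e1, e1, pair_step _ _ b hq, pair_step _ _ c hq, pair_step _ _ d hq, e_step1 _ _ _ hq he _ h h0,
    n_step _ hq, qp_succ q q]
  generalize qp q (b * q) k / qp q (a * q ^ 2 * q / (b * q)) k = X1
  generalize qp q (c * q) k / qp q (a * q ^ 2 * q / (c * q)) k = X2
  generalize qp q (d * q) k / qp q (a * q ^ 2 * q / (d * q)) k = X3
  generalize qp q (e * q) k / qp q (a * q ^ 2 * q / (e * q)) k = X4
  generalize (1 - b) / (1 - a * q / b) = Y1
  generalize (1 - c) / (1 - a * q / c) = Y2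
  generalize (1 - d) / (1 - a * q / d) = Y3
  generalize (1 - e * q ^ (k+1)) * (1 - a * q ^ (k+1) / e) / ((1 - a / e) * (1 - a * q / e)) = Y4
  generalize 1 - 1 / q ^ (N+1) = Z
  rw [show q * q ^ k = q ^ (k+1) by ring]
  generalize 1 - q ^ (k+1) = W
  rw [pow_succ q k]
  ring

lemma jw_step2 (q a b c d e : ℂ) (hq : q ≠ 0) (N k : ℕ) :
    jw q a b c d e N (k+1) =
      jw q (a * q ^ 2) (b * q) (c * q) (d * q) (e * q) N k *
      (q * ((1 - b) / (1 - a * q / b)) * ((1 - c) / (1 - a * q / c)) * ((1 - d) / (1 - a * q / d)) *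
       ((1 - e) / (1 - a * q / e)) *
       ((1 - q ^ k / q ^ N) / (1 - q ^ (k+1)))) := by
  have e1 : ∀ a b c d e N k, jw q a b c d e N k = (qp q b k / qp q (a * q / b) k) * (qp q c k / qp q (a * q / c) k)
     * (qp q d k / qp q (a * q / d) k) * (qp q e k / qp q (a * q / e) k) * (qp q ((q ^ N)⁻¹) k * q ^ k / qp q q k) := by
    intros; unfold jw; ring
  rw [e1, e1, pair_step _ _ b hq, pair_step _ _ c hq, pair_step _ _ d hq, pair_step _ _ e hq,
    qp_succ q q, qp_succ q (_)⁻¹]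
  generalize qp q (b * q) k / qp q (a * q ^ 2 * q / (b * q)) k = X1
  generalize qp q (c * q) k / qp q (a * q ^ 2 * q / (c * q)) k = X2
  generalize qp q (d * q) k / qp q (a * q ^ 2 * q / (d * q)) k = X3
  generalize qp q (e * q) k / qp q (a * q ^ 2 * q / (e * q)) k = X4
  generalize (1 - b) / (1 - a * q / b) = Y1
  generalize (1 - c) / (1 - a * q / c) = Y2
  generalize (1 - d) / (1 - a * q / d) = Y3
  generalize (1 - e) / (1 - a * q / e) = Y4
  rw [inv_mul_eq_div]
  generalize 1 - q ^ k / q ^ N = Z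
  rw [show q * q ^ k = q ^ (k+1) by ring]
  generalize 1 - q ^ (k+1) = W
  rw [pow_succ q k]
  ring

lemma jy_step0 (q a : ℂ) (k : ℕ) (h0 : 1 - a ≠ 0) (h1 : 1 - a * q ^ (k+1) ≠ 0) (h2 : 1 - a * q ^ 2 ≠ 0) :
    qp q a (k+1) * (1 - a * q ^ (2 * (k+1))) / (1 - a) =
     (1 - a * q) * (1 - a * q ^ 2) / (1 - a * q ^ (k+1)) *
      (qp q (a * q ^ 2) k * (1 - a * q ^ 2 * q ^ (2 * k)) / (1 - a * q ^ 2)) := by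
  have := qp_shift q (a * q) k
  rw [show a * q * q ^ k = a * q ^ (k+1) by ring, show a * q * q = a * q ^ 2 by ring] at this
  rw [qp_succ', show a * q ^ (2 * (k+1)) = a * q ^ 2 * q ^ (2 * k) by ring]
  have h3 : qp q (a * q) k = (1 - a * q) * qp q (a * q ^ 2) k / (1 - a * q ^ (k+1)) := by
    rw [this]; field_simp
  rw [h3]
  generalize qp q (a * q ^ 2) k = X
  generalize 1 - a * q ^ 2 * q ^ (2*k) = Y
  generalize 1 - a * q ^ (k+1) = Y at *
  generalize 1 - a * q ^ 2 = Y at *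
  generalize 1 - a * q = Y at *
  generalize 1 - a = Y at *
  field_simp

lemma jy_step1 (q a : ℂ) (N k : ℕ) (h0 : 1 - a ≠ 0) (h1 : 1 - a * q ^ (k+1) ≠ 0) (h2 : 1 - a * q ^ 2 ≠ 0) :
    jy q a (N+1) (k+1) = jy q (a * q ^ 2) N k *
      ((1 - a * q) * (1 - a * q ^ 2) / ((1 - a * q ^ (k+1)) * (1 - a * q ^ (N+2)))) := by
  unfold jy
  rw [← div_div, ← div_div, jy_step0 q a k h0 h1 h2, qp_succ', 
    show a * q ^ (N+1+1) * q = a * q ^ 2 * q ^ (N+1) by ring]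
  simp only [div_eq_mul_inv, mul_inv, inv_inv]
  ring

lemma jy_step2 (q a : ℂ) (N k : ℕ) (h0 : 1 - a ≠ 0) (h1 : 1 - a * q ^ (k+1) ≠ 0) (h2 : 1 - a * q ^ 2 ≠ 0)
    (h3 : 1 - a * q ^ (N + 2) ≠ 0) (h4 : 1 - a * q ^ (N + 2 + k) ≠ 0) :
    jy q a N (k+1) = jy q (a * q ^ 2) N k *
      ((1 - a * q) * (1 - a * q ^ 2) * (1 - a * q ^ (N+2+k)) / ((1 - a * q ^ (k+1)) * (1 - a * q ^ (N+1)) * (1 - a * q ^ (N+2)))) := by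
  unfold jy
  have := qp_shift q (a * q ^ (N+2)) k
  rw [show a * q ^ (N+2) * q ^ k = a * q ^ (N+2+k) by ring, show a * q ^ (N+2) * q = a * q ^ 2 * q ^ (N+1) by ring] at this
  have h5 : qp q (a * q ^ (N+2)) k = (1 - a * q ^ (N+2)) * qp q (a * q ^ 2 * q ^ (N+1)) k / (1 - a * q ^ (N+2+k)) := by
    rw [this]; field_simp
  rw [← div_div, ← div_div, jy_step0 q a k h0 h1 h2, qp_succ', 
    show a * q ^ (N+1) * q = a * q ^ (N+2) by ring, h5]
  simp only [div_eq_mul_inv, mul_inv, inv_inv]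
  ring

lemma jl_step (q a : ℂ) (N : ℕ) (h1 : 1 - a * q ^ (N+1) ≠ 0) (h2 : 1 - a * q ^ (N+2) ≠ 0) :
    jl q a (N+1) = jl q (a * q ^ 2) N *
      ((1 - a * q) * (1 - a * q ^ 2) / ((1 - a * q ^ (N+1)) * (1 - a * q ^ (N+2)))) := by
  unfold jl
  rcases N with _ | N
  · simp only [Nat.zero_sub, Nat.add_sub_cancel, zero_add, qp_zero, pow_one] at *
    simp [qp_zero]
    field_simp
  · simp only [Nat.add_sub_cancel]
    rw [qp_succ' q (a * q ^ _)]
    have := qp_shift q (a * q ^ 2) N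
    have h3 : qp q (a * q) (N+1) * (1 - a * q ^ (N+1+1)) = (1 - a * q) * (1 - a * q ^ 2) * qp q (a * q ^ 2 * q) N := by
      rw [mul_assoc, this, qp_succ', show a * q * q = a * q ^ 2 by ring]; ring
    rw [show a * q ^ (N+1+1+1) * q = a * q ^ 2 * q ^ (N+1+1) by ring]
    rw [show N + 1 + 2 = N + 1 + 1 + 1 by ring] at *
    generalize qp q (a * q) (N+1) = X at *
    generalize qp q (a * q ^ 2 * q ^ (N+1+1)) N = P at *
    generalize qp q (a * q ^ 2 * q) N = R at *
    generalize (1 - a * q) * (1 - a * q ^ 2) = S at *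
    generalize 1 - a * q ^ (N+1+1) = U at *
    generalize 1 - a * q ^ (N+1+1+1) = V at *
    have : X = S * R / U := by rw [← h3, mul_div_cancel_right₀ _ h1]
    rw [this]
    simp only [div_eq_mul_inv, mul_inv, inv_inv]
    ring

lemma d_id (a e Q x : ℂ) (he : e ≠ 0) (hx : x ≠ 0) :
   (1 - e * Q) * (1 - a * Q / e) * (1 - 1 / x) * (1 - a * x) -
     (1 - e) * (1 - a / e) * (1 - Q / x) * (1 - a * x * Q) =
    (e - 1 / x) * (1 - a * x / e) * ((1 - Q) * (1 - a * Q)) := by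
  field_simp; ring

lemma term_alg (q B C D W Y E1 E2 E3 A1 A2 Z1 Z2 U P V1 V2 V3 V4 κ : ℂ)
    (hA1 : A1 ≠ 0) (hA2 : A2 ≠ 0) (hU : U ≠ 0) (hV1 : V1 ≠ 0) (hV2 : V2 ≠ 0) (hV3 : V3 ≠ 0)
    (h : E1 * E2 * Z1 * V2 - E3 * A1 * Z2 * V4 = κ * (U * V1)) :
    W * (q * B * C * D * (E1 * E2 / (A1 * A2)) * (Z1 / U)) * (Y * (P / (V1 * V3))) -
    W * (q * B * C * D * (E3 / A2) * (Z2 / U)) * (Y * (P * V4 / (V1 * V2 * V3))) =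
    q * B * C * D * (P * κ / (A1 * A2 * V2 * V3)) * (W * Y) := by
  have : κ = (E1 * E2 * Z1 * V2 - E3 * A1 * Z2 * V4) / (U * V1) := by
    rw [h]; field_simp
  rw [this]; field_simp

lemma term_step (q a b c d e : ℂ) (hq : q ≠ 0) (he : e ≠ 0) (N k : ℕ)
    (h0 : 1 - a ≠ 0) (h1 : 1 - a * q ^ (k+1) ≠ 0) (h2 : 1 - a * q ^ 2 ≠ 0)
    (h3 : 1 - a * q ^ (N + 2) ≠ 0) (h4 : 1 - a * q ^ (N + 2 + k) ≠ 0) (h5 : 1 - a * q ^ (N + 1) ≠ 0)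
    (h6 : 1 - a * q / e * q ^ k ≠ 0) (h7 : 1 - a * q / e ≠ 0) (h8 : 1 - a / e ≠ 0)
    (h9 : 1 - q ^ (k+1) ≠ 0) :
    jw q a b c d (e * q) (N+1) (k+1) * jy q a (N+1) (k+1) - jw q a b c d e N (k+1) * jy q a N (k+1) =
    jK q a b c d e N * (jw q (a * q ^ 2) (b * q) (c * q) (d * q) (e * q) N k * jy q (a * q ^ 2) N k) := by
  rw [jw_step1 q a b c d e hq he N k h6 h7, jw_step2 q a b c d e hq N k, jy_step1 q a N k h0 h1 h2,
    jy_step2 q a N k h0 h1 h2 h3 h4]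
  unfold jK
  apply term_alg q _ _ _ _ _ _ _ _ _ _ _ _ _ _ _ _ _ _ _ h8 h7 h9 h1 h5 h3
  have := d_id a e (q ^ (k+1)) (q ^ (N+1)) he (pow_ne_zero _ hq)
  rw [← this]
  rw [show q ^ (k+1) / q ^ (N+1) = q ^ k / q ^ N by field_simp; ring]
  ring

lemma last_step (q a b c d e : ℂ) (hq : q ≠ 0) (he : e ≠ 0) (N : ℕ)
    (h1 : 1 - a * q ^ (N+1) ≠ 0)
    (h3 : 1 - a * q ^ (N + 2) ≠ 0)
    (h6 : 1 - a * q / e * q ^ N ≠ 0) (h7 : 1 - a * q / e ≠ 0)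
    (h9 : 1 - q ^ (N+1) ≠ 0) :
    jw q a b c d (e * q) (N+1) (N+1) * jl q a (N+1) =
    jK q a b c d e N * (jw q (a * q ^ 2) (b * q) (c * q) (d * q) (e * q) N N * jl q (a * q ^ 2) N) := by
  rw [jw_step1 q a b c d e hq he N N h6 h7, jl_step q a N h1 h3]
  unfold jK
  have hx : q ^ (N+1) ≠ 0 := pow_ne_zero _ hq
  have : (1 - e * q ^ (N+1)) * (1 - 1 / q ^ (N+1)) / (1 - q ^ (N+1)) = e - 1 / q ^ (N+1) := by
    rw [div_eq_iff h9]; field_simp; ring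
  rw [← this]
  simp only [div_eq_mul_inv, mul_inv]
  ring

lemma r_id (a b c d e x : ℂ) (ha : a ≠ 0) (hb : b ≠ 0) (hc : c ≠ 0) (hd : d ≠ 0) 
    (h : e = a ^ 2 * x / (b * c * d)) :
    (1 - a * x) * (1 - a * x / (b * c)) * (1 - a * x / (b * d)) * (1 - a * x / (c * d)) -
     (1 - a * x / b) * (1 - a * x / c) * (1 - a * x / d) * (1 - e / a) =
     (1 - b) * (1 - c) * (1 - d) * ((1 - e * x) * e / a) := by
  subst h; field_simp; ring

lemma k_id (q a e x : ℂ) (ha : a ≠ 0) (hq : q ≠ 0) (he : e ≠ 0) (hx : x ≠ 0)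
    (h7 : 1 - a * q / e ≠ 0) (h8 : 1 - a / e ≠ 0) (h9 : 1 - a * x / e ≠ 0) :
    q * ((e - 1 / x) * (1 - a * x / e)) / ((1 - a / e) * (1 - a * q / e)) * 
      ((1 - e / (a * q)) / (1 - e / (a * x))) = (1 - e * x) * e / a / (1 - e / a) := by
  have e1 : 1 - e / (a * q) = - (e / (a * q)) * (1 - a * q / e) := by field_simp; ring
  have e2 : 1 - e / (a * x) = - (e / (a * x)) * (1 - a * x / e) := by field_simp; ring
  have e3 : 1 - e / a = - (e / a) * (1 - a / e) := by field_simp; ring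
  rw [e1, e2, e3]
  generalize 1 - a * x / e = X at *
  generalize 1 - a * q / e = Y at *
  generalize 1 - a / e = Z at *
  field_simp
  ring

lemma r_pair (q a b : ℂ) (hq : q ≠ 0) (N : ℕ) (h : 1 - a * q / b ≠ 0) :
    qp q (a * q ^ 2 * q / (b * q)) N = qp q (a * q / b) N * (1 - a * q ^ (N+1) / b) / (1 - a * q / b) := by
  have := qp_shift q (a * q / b) N
  rw [show a * q ^ 2 * q / (b * q) = a * q / b * q by field_simp, eq_div_iff h, mul_comm, this]
  ring

lemma jr_alg (q Bb Cc Dd V P G G1 G2 G3 H1 H2 H3 H4 B C D Bn Cn Dn F E0 En T1 T2 T3 κ A M V3 : ℂ)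
    (hP : P ≠ 0) (hB : B ≠ 0) (hC : C ≠ 0) (hD : D ≠ 0) (hBn : Bn ≠ 0) (hCn : Cn ≠ 0) (hDn : Dn ≠ 0)
    (hV : V ≠ 0) (hV3 : V3 ≠ 0) (hF : F ≠ 0) (hEn : En ≠ 0) (hA : A ≠ 0)
    (h1 : H1 ≠ 0) (h2 : H2 ≠ 0) (h3 : H3 ≠ 0) (h4 : H4 ≠ 0) (hE0 : E0 ≠ 0)
    (hr : V * T1 * T2 * T3 - Bn * Cn * Dn * En = Bb * Cc * Dd * M)
    (hk : q * κ / A * (F / E0) = M / En) :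
    G * V * (G1 * T1) * (G2 * T2) * (G3 * T3) / (H1 * Bn * (H2 * Cn) * (H3 * Dn) * (H4 * En)) -
     G * G1 * G2 * G3 / (H1 * H2 * H3 * H4) =
     q * (Bb / B) * (Cc / C) * (Dd / D) * (P * κ / (A * V * V3)) *
      (G * V * V3 / P * G1 * G2 * G3 / (H1 * Bn / B * (H2 * Cn / C) * (H3 * Dn / D) * (H4 * E0 / F))) := by
  have : M = q * κ / A * (F / E0) * En := by rw [hk]; field_simp
  have e1 : G * V * (G1 * T1) * (G2 * T2) * (G3 * T3) / (H1 * Bn * (H2 * Cn) * (H3 * Dn) * (H4 * En)) -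
     G * G1 * G2 * G3 / (H1 * H2 * H3 * H4) = G * G1 * G2 * G3 * (V * T1 * T2 * T3 - Bn * Cn * Dn * En) / (H1 * Bn * (H2 * Cn) * (H3 * Dn) * (H4 * En)) := by
    field_simp
  rw [e1, hr, this]
  field_simp

lemma jr_step (q a b c d e : ℂ) (hq : q ≠ 0) (ha : a ≠ 0) (hb : b ≠ 0) (hc : c ≠ 0) (hd : d ≠ 0)
    (he : e ≠ 0) (N : ℕ) (h : e = a ^ 2 * q ^ (N+1) / (b * c * d))
    (g1 : 1 - a * q ≠ 0) (g2 : 1 - a * q ^ 2 ≠ 0) 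
    (h1 : 1 - a * q ^ (N+1) ≠ 0) (h3 : 1 - a * q ^ (N + 2) ≠ 0)
    (hB : ∀ j < N+1, 1 - a * q / b * q ^ j ≠ 0) (hC : ∀ j < N+1, 1 - a * q / c * q ^ j ≠ 0)
    (hD : ∀ j < N+1, 1 - a * q / d * q ^ j ≠ 0)
    (hE : ∀ j < N + 2, 1 - a / e * q ^ j ≠ 0) :
    jr q a b c d (N+1) - jr q a b c d N =
      jK q a b c d e N * jr q (a * q ^ 2) (b * q) (c * q) (d * q) N := by
  have hx : q ^ (N+1) ≠ 0 := pow_ne_zero _ hq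
  have hf : a / (b * c * d) = e / (a * q ^ (N+1)) := by rw [h]; field_simp
  have hB0 : 1 - a * q / b ≠ 0 := by simpa using hB 0 (by omega)
  have hC0 : 1 - a * q / c ≠ 0 := by simpa using hC 0 (by omega)
  have hD0 : 1 - a * q / d ≠ 0 := by simpa using hD 0 (by omega)
  have hBN : 1 - a * q ^ (N+1) / b ≠ 0 := by
    have := hB N (by omega); rwa [show a * q / b * q ^ N = a * q ^ (N+1) / b by ring] at this
  have hCN : 1 - a * q ^ (N+1) / c ≠ 0 := by
    have := hC N (by omega); rwa [show a * q / c * q ^ N = a * q ^ (N+1) / c by ring] at this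
  have hDN : 1 - a * q ^ (N+1) / d ≠ 0 := by
    have := hD N (by omega); rwa [show a * q / d * q ^ N = a * q ^ (N+1) / d by ring] at this
  have hE' : ∀ j, j < N+2 → 1 - e / (a * q ^ j) ≠ 0 := by
    intro j hj h'
    apply hE j hj
    have : q ^ j ≠ 0 := pow_ne_zero _ hq
    have h2 : e / (a * q ^ j) = 1 := by linear_combination -h'
    have h3 : e = a * q ^ j := by rw [div_eq_iff (by positivity)] at h2; simpa using h2
    rw [h3]; field_simp; ring
  have hE0 : 1 - e / (a * q ^ (N+1)) ≠ 0 := hE' _ (by omega)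
  have hEa : 1 - e / a ≠ 0 := by simpa using hE' 0 (by omega)
  have hEq : 1 - e / (a * q) ≠ 0 := by simpa using hE' 1 (by omega)
  have hA0 : 1 - a / e ≠ 0 := by simpa using hE 0 (by omega)
  have hA1 : 1 - a * q / e ≠ 0 := by
    have := hE 1 (by omega); rwa [show a / e * q ^ 1 = a * q / e by ring] at this
  have hAx : 1 - a * q ^ (N+1) / e ≠ 0 := by
    have := hE (N+1) (by omega); rwa [show a / e * q ^ (N+1) = a * q ^ (N+1) / e by ring] at this
  have H1 : qp q (a * q / b) N ≠ 0 := qp_ne.2 fun j hj => hB j (by omega)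
  have H2 : qp q (a * q / c) N ≠ 0 := qp_ne.2 fun j hj => hC j (by omega)
  have H3 : qp q (a * q / d) N ≠ 0 := qp_ne.2 fun j hj => hD j (by omega)
  have H4 : qp q (a * q / (b * c * d)) N ≠ 0 := by
    refine qp_ne.2 fun j hj => ?_
    have := hE' (N - j) (by omega)
    have h5 : q ^ (N+1) = q ^ (N-j) * q ^ j * q := by rw [← pow_add, ← pow_succ]; congr 1; omega
    have : q ^ j ≠ 0 := pow_ne_zero _ hq
    rwa [show a * q / (b * c * d) * q ^ j = a / (b * c * d) * q * q ^ j by ring, hf, h5,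
      show e / (a * (q ^ (N-j) * q ^ j * q)) * q * q ^ j = e / (a * q ^ (N-j)) by field_simp]
  have s1 : qp q (a * q ^ 2 * q) N = qp q (a * q) N * (1 - a * q ^ (N+1)) * (1 - a * q ^ (N+2)) / ((1 - a * q) * (1 - a * q ^ 2)) := by
    rw [eq_div_iff (mul_ne_zero g1 g2)]
    have t1 := qp_shift q (a * q) N
    have t2 := qp_shift q (a * q ^ 2) N
    rw [show a * q * q = a * q ^ 2 by ring] at t1
    linear_combination (1 - a * q) * t2 + (1 - a * q ^ 2 * q ^ N) * t1
  have s2 : qp q (a * q ^ 2 * q / (b * q * (c * q) * (d * q))) N =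
     qp q (a * q / (b * c * d)) N * (1 - e / (a * q ^ (N+1))) / (1 - e / (a * q)) := by
    have t := qp_shift q (a / (b * c * d)) N
    rw [show a * q ^ 2 * q / (b * q * (c * q) * (d * q)) = a / (b * c * d) by field_simp, eq_div_iff hEq]
    rw [hf, show e / (a * q ^ (N+1)) * q ^ N = e / (a * q) by field_simp; ring] at t
    rw [hf, ← t, mul_comm, show a * q / (b * c * d) = a / (b * c * d) * q by ring, hf]
  have r := r_id a b c d e (q ^ (N+1)) ha hb hc hd h
  have k := k_id q a e (q ^ (N+1)) ha hq he hx hA1 hA0 hAx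
  unfold jr jK
  simp only [qp_succ _ _ N]
  rw [r_pair q a b hq N hB0, r_pair q a c hq N hC0, r_pair q a d hq N hD0, s1, s2]
  have w : ∀ y, a * q / y * q ^ N = a * q ^ (N+1) / y := by intro y; ring
  have w2 : a * q ^ (N+1) / (b * c * d) = e / a := by
    rw [mul_div_right_comm, hf]; field_simp
  simp only [w, w2]
  rw [show a * q * q ^ N = a * q ^ (N+1) by ring,
    show a * q ^ 2 * q / (b * q * (c * q)) = a * q / (b * c) by field_simp,
    show a * q ^ 2 * q / (b * q * (d * q)) = a * q / (b * d) by field_simp,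
    show a * q ^ 2 * q / (c * q * (d * q)) = a * q / (c * d) by field_simp]
  exact jr_alg _ _ _ _ _ _ _ _ _ _ _ _ _ _ _ _ _ _ _ _ _ _ _ _ _ _ _ _ _ _ (mul_ne_zero g1 g2) hB0 hC0 hD0 hBN hCN hDN
    h1 h3 hEq hEa (mul_ne_zero hA0 hA1) H1 H2 H3 H4 hE0 r k

lemma jackson_one (q a b c d e : ℂ) (hq : q ≠ 0) (ha : a ≠ 0) (hb : b ≠ 0) (hc : c ≠ 0) (hd : d ≠ 0)
    (he : e ≠ 0) (h : e = a ^ 2 * q / (b * c * d)) (hQ : 1 - q ≠ 0)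
    (hB : 1 - a * q / b ≠ 0) (hC : 1 - a * q / c ≠ 0) (hD : 1 - a * q / d ≠ 0) (hE : 1 - a / e ≠ 0) :
    1 + jw q a b c d (e * q) 1 1 = jr q a b c d 1 := by
  have r := r_id a b c d e q ha hb hc hd h
  have e3 : 1 - e / a = - (e / a) * (1 - a / e) := by field_simp; ring
  have w2 : a * q / (b * c * d) = e / a := by rw [h]; field_simp
  have s : (1 - q⁻¹) * q / (1 - q) = -1 := by field_simp; ring
  unfold jw jr
  simp only [qp_succ _ _ 0, qp_zero, pow_zero, one_mul, mul_one, pow_one]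
  rw [w2, show a * q / (e * q) = a / e by field_simp]
  have hE2 : 1 - e / a ≠ 0 := by
    rw [e3]; exact mul_ne_zero (neg_ne_zero.2 (div_ne_zero he ha)) hE
  have t : (1 - b) * (1 - c) * (1 - d) * (1 - e * q) * (1 - q⁻¹) * q /
    ((1 - q) * (1 - a * q / b) * (1 - a * q / c) * (1 - a * q / d) * (1 - a / e)) =
    ((1 - b) * (1 - c) * (1 - d) * ((1 - e * q) * e / a)) /
     ((1 - a * q / b) * (1 - a * q / c) * (1 - a * q / d) * (1 - e / a)) := by
    rw [e3]
    have : 1 - q⁻¹ = - (1 - q) / q := by field_simp; ring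
    rw [this]
    generalize 1 - q = X1 at *
    generalize 1 - a * q / b = X1 at *
    generalize 1 - a * q / c = X1 at *
    generalize 1 - a * q / d = X1 at *
    generalize 1 - a / e = X1 at *
    generalize 1 - e * q = X1 at *
    field_simp
  rw [t, ← r]
  generalize 1 - e / a = X1 at *
  generalize 1 - a * q / b = X1 at *
  generalize 1 - a * q / c = X1 at *
  generalize 1 - a * q / d = X1 at *
  field_simp
  ring

lemma jy_zero (q a : ℂ) (N : ℕ) (h : 1 - a ≠ 0) : jy q a N 0 = 1 := by
  simp [jy, qp_zero, h]

lemma jw_zero (q a b c d e : ℂ) (N : ℕ) : jw q a b c d e N 0 = 1 := by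
  simp [jw, qp_zero]

lemma jl_eq_jy (q a : ℂ) (N : ℕ) (h0 : 1 - a ≠ 0) (h : 1 - a * q ^ (2 * N) ≠ 0) :
    jl q a N = jy q a N N := by
  rcases N with _ | N
  · rw [jy_zero _ _ _ h0]; simp [jl, qp_zero]
  · unfold jl jy
    rw [qp_succ', qp_succ, show a * q ^ (N+1+1) * q ^ N = a * q ^ (2 * (N+1)) by ring]
    simp only [Nat.add_sub_cancel]
    generalize 1 - a * q ^ (2 * (N+1)) = X at *
    generalize 1 - a = X at *
    rw [mul_assoc, mul_div_mul_left _ _ h0, mul_div_mul_right _ _ h]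

theorem jackson (q : ℂ) (hq : q ≠ 0) (N : ℕ) : ∀ (a b c d e : ℂ) (_ : a ≠ 0) (_ : b ≠ 0) (_ : c ≠ 0) (_ : d ≠ 0)
    (_ : e ≠ 0) (_ : e = a ^ 2 * q ^ (N+1) / (b * c * d))
    (_ : ∀ j < N, 1 - q ^ (j+1) ≠ 0) (_ : ∀ j < 2 * N, 1 - a * q ^ j ≠ 0)
    (_ : ∀ j < N, 1 - a * q / b * q ^ j ≠ 0) (_ : ∀ j < N, 1 - a * q / c * q ^ j ≠ 0)
    (_ : ∀ j < N, 1 - a * q / d * q ^ j ≠ 0)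
    (_ : ∀ j < 2 * N, 1 - a * q / e * q ^ j ≠ 0),
    ∑ k ∈ range N, jw q a b c d e N k * jy q a N k + jw q a b c d e N N * jl q a N =
      jr q a b c d N := by
  induction N with
  | zero => intros; simp [jw_zero, jl, jr, qp_zero]
  | succ N ih =>
    intro a b c d E ha hb hc hd hE hEq hQ hA hB hC hD hE'
    obtain ⟨e, rfl⟩ : ∃ e, E = e * q := ⟨E / q, by field_simp⟩
    have he : e ≠ 0 := left_ne_zero_of_mul hE
    have heq : e = a ^ 2 * q ^ (N+1) / (b * c * d) := by
      have : e * q = a ^ 2 * q ^ (N+1) / (b * c * d) * q := by rw [hEq]; ring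
      exact mul_right_cancel₀ hq this
    have hE2 : ∀ j < 2 * (N+1), 1 - a / e * q ^ j ≠ 0 := by
      intro j hj; have := hE' j hj; rwa [show a * q / (e * q) = a / e by field_simp] at this
    have hA0 : 1 - a ≠ 0 := by simpa using hA 0 (by omega)
    have hB0 : 1 - a * q / b ≠ 0 := by simpa using hB 0 (by omega)
    have hC0 : 1 - a * q / c ≠ 0 := by simpa using hC 0 (by omega)
    have hD0 : 1 - a * q / d ≠ 0 := by simpa using hD 0 (by omega)
    have hE0 : 1 - a / e ≠ 0 := by simpa using hE2 0 (by omega)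
    have hE3 : ∀ j < 2 * N + 1, 1 - a * q / e * q ^ j ≠ 0 := by
      intro j hj; have := hE2 (j+1) (by omega)
      rwa [show a / e * q ^ (j+1) = a * q / e * q ^ j by ring] at this
    have hE1 : 1 - a * q / e ≠ 0 := by simpa using hE3 0 (by omega)
    rcases Nat.eq_zero_or_pos N with rfl | hN
    · simp only [zero_add, range_one, sum_singleton, jw_zero, jy_zero q a _ hA0]
      rw [show jl q a 1 = 1 by simp [jl, qp_zero]]
      have := jackson_one q a b c d e hq ha hb hc hd he (by simpa using heq) (by simpa using hQ 0 (by omega)) hB0 hC0 hD0 hE0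
      simpa using this
    · have i1 := ih a b c d e ha hb hc hd he heq (fun j hj => hQ j (by omega)) (fun j hj => hA j (by omega))
        (fun j hj => hB j (by omega)) (fun j hj => hC j (by omega)) (fun j hj => hD j (by omega))
        (fun j hj => hE3 j (by omega))
      have sh : ∀ b : ℂ, (∀ j < N+1, 1 - a * q / b * q ^ j ≠ 0) → ∀ j < N, 1 - a * q ^ 2 * q / (b * q) * q ^ j ≠ 0 := by
        intro b hb j hj; have := hb (j+1) (by omega)
        rwa [show a * q ^ 2 * q / (b * q) * q ^ j = a * q / b * q ^ (j+1) by field_simp; ring]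
      have i2 := ih (a * q ^ 2) (b * q) (c * q) (d * q) (e * q) (by positivity) (by positivity) (by positivity)
        (by positivity) hE (by rw [hEq]; field_simp; ring) (fun j hj => hQ j (by omega))
        (fun j hj => by
          have := hA (j+2) (by omega)
          rwa [show a * q ^ 2 * q ^ j = a * q ^ (j+2) by ring])
        (sh b hB) (sh c hC) (sh d hD)
        (fun j hj => by
          have := hE3 (j+1) (by omega)
          rwa [show a * q ^ 2 * q / (e * q) * q ^ j = a * q / e * q ^ (j+1) by field_simp; ring])
      have hr := jr_step q a b c d e hq ha hb hc hd he N heq (by simpa using hA 1 (by omega)) (hA 2 (by omega))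
        (hA _ (by omega)) (hA _ (by omega)) hB hC hD (fun j hj => hE2 j (by omega))
      have hl := last_step q a b c d e hq he N (hA _ (by omega)) (hA _ (by omega)) (hE3 N (by omega)) hE1 (hQ N (by omega))
      rw [jl_eq_jy q a N hA0 (hA _ (by omega)), ← Finset.sum_range_succ (fun k => jw q a b c d e N k * jy q a N k),
        Finset.sum_range_succ'] at i1
      rw [Finset.sum_range_succ']
      simp only [jw_zero, jy_zero q a _ hA0] at i1 ⊢
      have hs : ∑ k ∈ range N, jw q a b c d (e * q) (N+1) (k+1) * jy q a (N+1) (k+1) =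
          ∑ k ∈ range N, jw q a b c d e N (k+1) * jy q a N (k+1) +
          jK q a b c d e N * ∑ k ∈ range N, jw q (a * q ^ 2) (b * q) (c * q) (d * q) (e * q) N k * jy q (a * q ^ 2) N k := by
        rw [Finset.mul_sum, ← Finset.sum_add_distrib]
        apply Finset.sum_congr rfl
        intro k hk
        rw [Finset.mem_range] at hk
        have := term_step q a b c d e hq he N k hA0 (hA _ (by omega)) (hA _ (by omega)) (hA _ (by omega))
          (hA _ (by omega)) (hA _ (by omega)) (hE3 k (by omega)) hE1 hE0 (hQ k (by omega))
        linear_combination this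
      rw [hs, hl]
      linear_combination i1 + jK q a b c d e N * i2 - hr

lemma qp_rev (q x y : ℂ) (m : ℕ) (h : x * y * q ^ m = q) (hq : q ≠ 0) :
    qp q x m = qp q y m * ∏ i ∈ range m, (-(x * q ^ i)) := by
  unfold qp
  rw [← Finset.prod_range_reflect (fun i => -(x * q ^ i)), ← Finset.prod_mul_distrib,
    ← Finset.prod_range_reflect]
  apply Finset.prod_congr rfl
  intro j hj
  rw [Finset.mem_range] at hj
  have : q ^ m = q ^ (m - 1 - j) * q ^ j * q := by rw [← pow_add, ← pow_succ]; congr 1; omega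
  rw [this] at h
  have h2 : x * y * (q ^ (m - 1 - j) * q ^ j) = 1 := mul_right_cancel₀ hq (by linear_combination h)
  linear_combination -h2

lemma prod_neg_pow (q x : ℂ) (m : ℕ) : ∏ i ∈ range m, (-(x * q ^ i)) = (-x) ^ m * q ^ (∑ i ∈ range m, i) := by
  induction m with
  | zero => simp
  | succ m ih => rw [Finset.prod_range_succ, ih, Finset.sum_range_succ, pow_add q, pow_succ (-x)]; ring

noncomputable def rho (q a b : ℂ) (k : ℕ) : ℂ := qp q b k / qp q (a * q / b) k

lemma rho_refl (q a b : ℂ) (hq : q ≠ 0) (hb : b ≠ 0) (n k L : ℕ) (hn : 2 * k + L = n) (ha : a * q ^ n = 1)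
    (h : qp q (a * q / b) n ≠ 0) :
    rho q a b (k + L) = rho q a b k * ∏ i ∈ range L, (-(b * q ^ (k + i))) := by
  have h1 : qp q (a * q / b * q ^ k) L ≠ 0 := by
    rw [show n = k + L + k by omega, qp_add, qp_add] at h
    exact right_ne_zero_of_mul (left_ne_zero_of_mul h)
  have h2 := qp_rev q (b * q ^ k) (a * q / b * q ^ k) L (by
    rw [← hn] at ha
    have : b * q ^ k * (a * q / b * q ^ k) * q ^ L = (a * q ^ (2 * k + L)) * q := by field_simp; ring
    rw [this, ha, one_mul]) hq
  unfold rho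
  rw [qp_add, qp_add, h2]
  simp only [mul_assoc, ← pow_add]
  generalize qp q (a * q / b * q ^ k) L = X at *
  generalize qp q (a * q / b) k = Y at *
  generalize ∏ x ∈ range L, -(b * q ^ (k + x)) = P
  rw [mul_left_comm, mul_comm Y, mul_div_mul_left _ _ h1]
  ring

noncomputable def TT (q a b c d e : ℂ) (k : ℕ) : ℂ :=
  rho q a a k * rho q a b k * rho q a c k * rho q a d k * rho q a e k * q ^ k

lemma TT_refl (q a b c d e : ℂ) (hq : q ≠ 0) (ha0 : a ≠ 0) (hb : b ≠ 0) (hc : c ≠ 0) (hd : d ≠ 0) (he : e ≠ 0) 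
    (n k L : ℕ) (hn : 2 * k + L = n) (ha : a * q ^ n = 1)
    (h1 : qp q q n ≠ 0)
    (h2 : qp q (a * q / b) n ≠ 0) (h3 : qp q (a * q / c) n ≠ 0) (h4 : qp q (a * q / d) n ≠ 0)
    (h5 : qp q (a * q / e) n ≠ 0) :
    TT q a b c d e (k + L) = TT q a b c d e k * ((-(a * b * c * d * e)) ^ L * q ^ (L + 5 * k * L + 5 * ∑ i ∈ range L, i)) := by
  unfold TT
  rw [rho_refl q a a hq ha0 n k L hn ha (by rwa [show a * q / a = q by field_simp]),
    rho_refl q a b hq hb n k L hn ha h2, rho_refl q a c hq hc n k L hn ha h3,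
    rho_refl q a d hq hd n k L hn ha h4, rho_refl q a e hq he n k L hn ha h5]
  have : ∀ x : ℂ, ∏ i ∈ range L, (-(x * q ^ (k + i))) = (-x) ^ L * q ^ (k * L) * q ^ (∑ i ∈ range L, i) := by
    intro x
    have := prod_neg_pow q (x * q ^ k) L
    simp only [mul_assoc, ← pow_add] at this
    rw [this, ← neg_mul, mul_pow, ← pow_mul]
  simp only [this]
  simp only [neg_pow a L, neg_pow b L, neg_pow c L, neg_pow d L, neg_pow e L, neg_pow (a*b*c*d*e) L]
  have h6 : ((-1 : ℂ) ^ L) ^ 2 = 1 := by rw [← pow_mul, mul_comm, pow_mul]; simp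
  generalize ((-1 : ℂ) ^ L) = s at *
  generalize ∑ i ∈ range L, i = σ
  have h7 : s ^ 5 = s := by linear_combination (s ^ 3 + s) * h6
  ring_nf
  rw [h7]

lemma sum_id_odd (l : ℕ) : ∑ i ∈ range (2 * l + 1), i = (2 * l + 1) * l := by
  have := Finset.sum_range_id_mul_two (2 * l + 1)
  simp only [Nat.add_sub_cancel] at this
  nlinarith

lemma sum_id_even (l : ℕ) : ∑ i ∈ range (2 * l), i + l = 2 * l * l := by
  have := sum_id_odd l
  rw [Finset.sum_range_succ] at this
  nlinarith

lemma core_sum (q a b c d e : ℂ) (n m : ℕ) (hm : m = n / 2) (hq : q ≠ 0)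
    (ha0 : a ≠ 0) (hb : b ≠ 0) (hc : c ≠ 0) (hd : d ≠ 0) (he : e ≠ 0) 
    (hbcde : b * c * d * e = q ^ (1 + (m : ℤ) - 2 * n)) (ha' : a = q ^ (-(n:ℤ)))
    (ha : a * q ^ n = 1)
    (h1 : qp q q n ≠ 0)
    (h2 : qp q (a * q / b) n ≠ 0) (h3 : qp q (a * q / c) n ≠ 0) (h4 : qp q (a * q / d) n ≠ 0)
    (h5 : qp q (a * q / e) n ≠ 0) :
    ∃ Z, ∑ k ∈ range (n + 1), TT q a b c d e k = Z * jr q a b d e m ∧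
     Z * qp q (a * q) m * qp q ((q ^ m)⁻¹) m = qp q a n := by
  have hQ : ∀ j < n, 1 - q ^ (j+1) ≠ 0 := by
    intro j hj; have := qp_ne.1 h1 j hj; rwa [show q * q ^ j = q ^ (j+1) by ring] at this
  have hQi : ∀ x : ℂ, ∀ j, 0 < j → j ≤ n → x * q ^ j = 1 → 1 - x ≠ 0 := by
    intro x j h0 hj hx h'
    have : x = 1 := by linear_combination -h'
    apply hQ (j - 1) (by omega)
    rw [Nat.sub_add_cancel h0, ← hx, this]; ring
  have hA : ∀ j < n, 1 - a * q ^ j ≠ 0 := by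
    intro j hj
    apply hQi _ (n - j) (by omega) (by omega)
    rw [mul_assoc, ← pow_add, ← ha]; congr 2; omega
  have hM : a * b * c * d * e = q ^ (1 + (m : ℤ) - 3 * n) := by
    rw [show a * b * c * d * e = a * (b * c * d * e) by ring, hbcde, ha', ← zpow_add₀ hq]; congr 1; ring
  have J := jackson q hq m a b d e c ha0 hb hd he hc (by
      rw [eq_div_iff (by positivity), show c * (b * d * e) = b * c * d * e by ring, hbcde, ha',
        ← zpow_natCast, ← zpow_natCast, ← zpow_mul, ← zpow_add₀ hq]; congr 1; push_cast; ring)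
    (fun j hj => hQ j (by omega)) (fun j hj => hA j (by omega)) (fun j hj => qp_ne.1 h2 j (by omega))
    (fun j hj => qp_ne.1 h4 j (by omega)) (fun j hj => qp_ne.1 h5 j (by omega))
    (fun j hj => qp_ne.1 h3 j (by omega))
  have hqm : ∀ k ≤ m, qp q ((q ^ m)⁻¹) k ≠ 0 := by
    intro k hk
    refine qp_ne.2 fun j hj => ?_
    apply hQi _ (m - j) (by omega) (by omega)
    rw [mul_assoc, ← pow_add, show j + (m - j) = m by omega, inv_mul_cancel₀ (pow_ne_zero _ hq)]
  have hT : ∀ k ≤ m, jw q a b d e c m k * qp q a k = TT q a b c d e k * qp q ((q ^ m)⁻¹) k := by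
    intro k hk
    unfold jw TT rho
    rw [show a * q / a = q by field_simp]
    simp only [div_eq_mul_inv, mul_inv]
    ring
  rcases Nat.even_or_odd n with ⟨m', hn⟩ | ⟨m', hn⟩
  · obtain rfl : m' = m := by omega
    rcases Nat.eq_zero_or_pos m' with rfl | hm0
    · have : n = 0 := by omega
      subst this
      refine ⟨1, ?_, ?_⟩ <;> simp [TT, rho, jr, qp_zero]
    set m := m'
    set r := (q ^ m)⁻¹ with hr
    have hr0 : r ≠ 0 := inv_ne_zero (pow_ne_zero _ hq)
    have hrq : r * q ^ m = 1 := inv_mul_cancel₀ (pow_ne_zero _ hq)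
    have har : a = r ^ 2 := by
      have : a * q ^ n = r ^ 2 * q ^ n := by rw [ha, hn, pow_add]; linear_combination -(r * q ^ m + 1) * hrq
      exact mul_right_cancel₀ (pow_ne_zero _ hq) this
    have haqm : a * q ^ m = r := by rw [har]; linear_combination r * hrq
    have h1a : 1 - a ≠ 0 := by simpa using hA 0 (by omega)
    have hfac : 1 - a = (1 - r) * (1 + r) := by rw [har]; ring
    have h1r : 1 - r ≠ 0 := fun h => h1a (by rw [hfac, h, zero_mul])
    have h1r' : 1 + r ≠ 0 := fun h => h1a (by rw [hfac, h, mul_zero])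
    have hrq1 : a * q ^ (m+1) = r * q := by rw [pow_succ, ← mul_assoc, haqm]
    have hrk : ∀ k < m, 1 - r * q ^ k ≠ 0 := fun k hk => qp_ne.1 (hqm m le_rfl) k hk
    refine ⟨1 + r, ?_, ?_⟩
    · rw [← J]
      have s1 : ∀ k < m, (1 + r) * (jw q a b d e c m k * jy q a m k) = TT q a b c d e k * (1 + r * q ^ k) := by
        intro k hk
        have t := hT k hk.le
        have u := qp_shift q r k
        have u1 : qp q (r * q) k = qp q r k * (1 - r * q ^ k) / (1 - r) := by rw [← u]; field_simp
        have v := hrk k hk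
        have w := hqm k hk.le
        unfold jy
        rw [hrq1, u1, hfac, show 1 - a * q ^ (2 * k) = (1 - r * q ^ k) * (1 + r * q ^ k) by rw [har]; ring]
        have t' : TT q a b c d e k = jw q a b d e c m k * qp q a k / qp q r k := by rw [t]; field_simp
        rw [t']
        generalize 1 - r * q ^ k = X1 at *
        generalize 1 + r * q ^ k = X1 at *
        generalize 1 - r = X1 at *
        generalize 1 + r = X1 at *
        field_simp
      have s2 : (1 + r) * (jw q a b d e c m m * jl q a m) = TT q a b c d e m := by
        have t := hT m le_rfl
        have w := hqm m le_rfl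
        unfold jl
        rw [hrq1]
        obtain ⟨p, hp⟩ : ∃ p, m = p + 1 := ⟨m - 1, by omega⟩
        have t' : TT q a b c d e m = jw q a b d e c m m * qp q a m / qp q r m := by rw [t]; field_simp
        rw [t']
        generalize jw q a b d e c m m = W
        clear_value r
        clear_value m
        subst hp
        rw [qp_succ' q r] at w
        rw [Nat.add_sub_cancel, qp_succ', qp_succ' q r, hfac]
        have w2 := right_ne_zero_of_mul w
        generalize 1 - r = X1 at *
        generalize 1 + r = X1 at *
        field_simp
      have s3 : ∀ k < m, TT q a b c d e (2 * m - k) = TT q a b c d e k * (r * q ^ k) := by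
        intro k hk
        obtain ⟨l, hl⟩ := Nat.exists_eq_add_of_le hk.le
        have := TT_refl q a b c d e hq ha0 hb hc hd he n k (2 * l) (by omega) ha h1 h2 h3 h4 h5
        rw [show 2 * m - k = k + 2 * l by omega, this]
        congr 1
        rw [hM, (even_two_mul l).neg_pow, hr]
        have e := sum_id_even l
        generalize ∑ i ∈ range (2 * l), i = σ at *
        rw [← zpow_natCast, ← zpow_natCast, ← zpow_natCast, ← zpow_natCast, ← zpow_neg, ← zpow_mul, ← zpow_add₀ hq, ← zpow_add₀ hq]
        congr 1
        have e' : (σ : ℤ) = 2 * l * l - l := by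
          have : (σ : ℤ) + l = 2 * l * l := by exact_mod_cast e
          linarith
        push_cast
        rw [e', hn, hl]; push_cast; ring
      rw [mul_add, s2, Finset.mul_sum, Finset.sum_congr rfl (fun k hk => s1 k (Finset.mem_range.1 hk))]
      rw [show n + 1 = (m + 1) + m by omega, Finset.sum_range_add, Finset.sum_range_succ,
        ← Finset.sum_range_reflect (fun k => TT q a b c d e (m + 1 + k))]
      have : ∑ j ∈ range m, TT q a b c d e (m + 1 + (m - 1 - j)) = ∑ j ∈ range m, TT q a b c d e j * (r * q ^ j) := by
        apply Finset.sum_congr rfl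
        intro k hk
        have hk := Finset.mem_range.1 hk
        rw [← s3 k hk]; congr 1; omega
      rw [this]
      simp only [mul_add, mul_one, Finset.sum_add_distrib]
      ring
    · have u := qp_shift q a m
      rw [haqm] at u
      have : (1 + r) * qp q (a * q) m = qp q a m := by
        apply mul_left_cancel₀ h1r
        rw [← mul_assoc, ← hfac, u]; ring
      rw [this, hn, qp_add, haqm]
  · obtain rfl : m' = m := by omega
    set m := m'
    have h1a : 1 - a ≠ 0 := by simpa using hA 0 (by omega)
    have hrq1 : a * q ^ (m+1) = (q ^ m)⁻¹ := by
      apply eq_inv_of_mul_eq_one_left; rw [← ha, hn]; ring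
    refine ⟨1 - a, ?_, ?_⟩
    · rw [jl_eq_jy q a m h1a (hA _ (by omega)), ← Finset.sum_range_succ (fun k => jw q a b d e c m k * jy q a m k)] at J
      rw [← J]
      have s1 : ∀ k ≤ m, (1 - a) * (jw q a b d e c m k * jy q a m k) = TT q a b c d e k * (1 - a * q ^ (2 * k)) := by
        intro k hk
        have t := hT k hk
        have w := hqm k hk
        unfold jy
        rw [hrq1]
        have t' : TT q a b c d e k = jw q a b d e c m k * qp q a k / qp q ((q^m)⁻¹) k := by
          rw [t, mul_div_cancel_right₀ _ w]
        rw [t']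
        generalize qp q ((q^m)⁻¹) k = X1 at *
        generalize 1 - a = X1 at *
        field_simp
      have s3 : ∀ k ≤ m, TT q a b c d e (2 * m + 1 - k) = TT q a b c d e k * (- (a * q ^ (2 * k))) := by
        intro k hk
        obtain ⟨l, hl⟩ := Nat.exists_eq_add_of_le hk
        have := TT_refl q a b c d e hq ha0 hb hc hd he n k (2 * l + 1) (by omega) ha h1 h2 h3 h4 h5
        rw [show 2 * m + 1 - k = k + (2 * l + 1) by omega, this]
        congr 1
        rw [hM, (odd_two_mul_add_one l).neg_pow, sum_id_odd, ha', neg_mul, neg_inj]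
        rw [← zpow_natCast, ← zpow_natCast, ← zpow_natCast, ← zpow_mul, ← zpow_add₀ hq, ← zpow_add₀ hq]
        congr 1
        push_cast
        rw [hn, hl]; push_cast; ring
      rw [Finset.mul_sum, Finset.sum_congr rfl (fun k hk => s1 k (Nat.lt_succ_iff.1 (Finset.mem_range.1 hk)))]
      rw [show n + 1 = (m + 1) + (m + 1) by omega, Finset.sum_range_add, 
        ← Finset.sum_range_reflect (fun k => TT q a b c d e (m + 1 + k))]
      have : ∑ j ∈ range (m+1), TT q a b c d e (m + 1 + (m + 1 - 1 - j)) = ∑ j ∈ range (m+1), TT q a b c d e j * (-(a * q ^ (2 * j))) := by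
        apply Finset.sum_congr rfl
        intro k hk
        have hk := Nat.lt_succ_iff.1 (Finset.mem_range.1 hk)
        rw [← s3 k hk]; congr 1; omega
      rw [this, ← Finset.sum_add_distrib]
      apply Finset.sum_congr rfl
      intros; ring
    · rw [hn, show 2 * m + 1 = (m + 1) + m by ring, qp_add, hrq1, qp_succ']

theorem stmt8 (q b c d e : ℂ) (n m : ℕ) (hm : m = n / 2) (hq : q ≠ 0)
    (hbcde : b * c * d * e = q ^ (1 + (m : ℤ) - 2 * n))
    (h1 : qp q q n ≠ 0)
    (h2 : qp q (q ^ (1 - (n : ℤ)) / b) n ≠ 0) (h3 : qp q (q ^ (1 - (n : ℤ)) / c) n ≠ 0)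
    (h4 : qp q (q ^ (1 - (n : ℤ)) / d) n ≠ 0) (h5 : qp q (q ^ (1 - (n : ℤ)) / e) n ≠ 0)
    (h6 : qp q (q ^ (n - m) * c) m ≠ 0) :
    (∑ k ∈ Finset.range (n + 1),
        (qp q (q ^ (-(n : ℤ))) k * qp q b k * qp q c k * qp q d k * qp q e k) /
          (qp q q k * qp q (q ^ (1 - (n : ℤ)) / b) k * qp q (q ^ (1 - (n : ℤ)) / c) k *
            qp q (q ^ (1 - (n : ℤ)) / d) k * qp q (q ^ (1 - (n : ℤ)) / e) k) * q ^ k) =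
      q ^ ((m : ℤ) * (1 + m - n)) * (d * e) ^ (-(m : ℤ)) *
        (qp q (q ^ (-(n : ℤ))) (2 * m) * qp q (q ^ (1 - (n : ℤ)) / (b * c)) m *
          qp q (q ^ (1 - (n : ℤ)) / (b * d)) m * qp q (q ^ (1 - (n : ℤ)) / (b * e)) m *
          qp q (q ^ (2 * (m : ℤ) - n)) (n - 2 * m)) /
        (qp q q m * qp q (q ^ (1 - (n : ℤ)) / b) m * qp q (q ^ (1 - (n : ℤ)) / d) m *
          qp q (q ^ (1 - (n : ℤ)) / e) m * qp q (q ^ (n - m) * c) m) := by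
  have hne : b * c * d * e ≠ 0 := by rw [hbcde]; exact zpow_ne_zero _ hq
  have he : e ≠ 0 := right_ne_zero_of_mul hne
  have hd : d ≠ 0 := right_ne_zero_of_mul (left_ne_zero_of_mul hne)
  have hc : c ≠ 0 := right_ne_zero_of_mul (left_ne_zero_of_mul (left_ne_zero_of_mul hne))
  have hb : b ≠ 0 := left_ne_zero_of_mul (left_ne_zero_of_mul (left_ne_zero_of_mul hne))
  obtain ⟨a, ha'⟩ : ∃ a : ℂ, a = q ^ (-(n : ℤ)) := ⟨_, rfl⟩
  have hA : q ^ (1 - (n : ℤ)) = a * q := by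
    rw [ha', ← zpow_add_one₀ hq]; congr 1; ring
  have ha0 : a ≠ 0 := by rw [ha']; exact zpow_ne_zero _ hq
  have ha : a * q ^ n = 1 := by
    rw [ha', ← zpow_natCast, ← zpow_add₀ hq]; simp
  have h2m : q ^ (2 * (m : ℤ) - n) = a * q ^ (2 * m) := by
    rw [ha', ← zpow_natCast, ← zpow_add₀ hq]; congr 1; push_cast; ring
  rw [hA] at h2 h3 h4 h5
  simp only [hA, h2m]
  rw [← ha']
  obtain ⟨Z, hZ, hZ2⟩ := core_sum q a b c d e n m hm hq ha0 hb hc hd he hbcde ha' ha h1 h2 h3 h4 h5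
  have hS : ∀ k, (qp q a k * qp q b k * qp q c k * qp q d k * qp q e k) /
          (qp q q k * qp q (a * q / b) k * qp q (a * q / c) k *
            qp q (a * q / d) k * qp q (a * q / e) k) * q ^ k = TT q a b c d e k := by
    intro k
    unfold TT rho
    rw [show a * q / a = q by field_simp]
    simp only [div_eq_mul_inv, mul_inv]
    ring
  simp only [hS]
  rw [hZ]
  have hn : qp q a n = qp q a (2 * m) * qp q (a * q ^ (2 * m)) (n - 2 * m) := by
    rw [← qp_add]; congr 1; omega
  have hcc : a * q / (b * d * e) = q ^ (n - m) * c := by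
    rw [div_eq_iff (by positivity), show q ^ (n - m) * c * (b * d * e) = q ^ (n - m) * (b * c * d * e) by ring,
      hbcde, ← hA, ← zpow_natCast, ← zpow_add₀ hq]
    congr 1
    rw [Nat.cast_sub (by omega)]; ring
  have R1 := qp_rev q (a * q / (d * e)) (a * q / (b * c)) m (by
    rw [div_mul_div_comm, show d * e * (b * c) = b * c * d * e by ring, hbcde, ← hA, ← zpow_add₀ hq, ← zpow_sub₀ hq,
      ← zpow_natCast, ← zpow_add₀ hq]
    nth_rewrite 2 [← zpow_one q]
    congr 1; ring) hq
  have R2 := qp_rev q ((q ^ m)⁻¹) q m (by have := pow_ne_zero m hq; field_simp) hq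
  rw [prod_neg_pow] at R1 R2
  have hP : ∀ {x : ℂ}, qp q x n ≠ 0 → qp q x m ≠ 0 := by
    intro x hx; rw [qp_ne] at *; exact fun j hj => hx j (by omega)
  have g1 := hP h1
  have g2 := hP h2
  have g4 := hP h4
  have g5 := hP h5
  have key : q ^ ((m : ℤ) * (1 + m - n)) * (d * e) ^ (-(m : ℤ)) * (-(q ^ m)⁻¹) ^ m = (-(a * q / (d * e))) ^ m := by
    rw [neg_pow, neg_pow (a * q / (d * e)), div_pow, zpow_neg, zpow_natCast, ← hA]
    have : q ^ ((m : ℤ) * (1 + m - n)) * ((q ^ m)⁻¹) ^ m = (q ^ (1 - (n:ℤ))) ^ m := by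
      rw [← zpow_natCast, ← zpow_natCast, ← zpow_natCast, ← zpow_neg, ← zpow_mul, ← zpow_mul, ← zpow_add₀ hq]
      congr 1; ring
    rw [← this]; ring
  unfold jr
  rw [hcc, R1]
  rw [show qp q a (2 * m) * qp q (a * q / (b * c)) m * qp q (a * q / (b * d)) m * qp q (a * q / (b * e)) m *
      qp q (a * q ^ (2 * m)) (n - 2 * m) = (qp q a (2 * m) * qp q (a * q ^ (2 * m)) (n - 2 * m)) *
       (qp q (a * q / (b * c)) m * qp q (a * q / (b * d)) m * qp q (a * q / (b * e)) m) by ring, ← hn, ← hZ2, R2, ← key]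
  generalize q ^ ((m : ℤ) * (1 + m - n)) * (d * e) ^ (-(m : ℤ)) = X1 at *
  generalize (-(q ^ m)⁻¹) ^ m = X2 at *
  generalize q ^ (∑ i ∈ range m, i) = X3 at *
  generalize qp q q m = Y1 at *
  generalize qp q (q ^ (n - m) * c) m = Y2 at *
  generalize qp q (a * q / b) m = Y3 at *
  generalize qp q (a * q / d) m = Y4 at *
  generalize qp q (a * q / e) m = Y5 at *
  field_simp
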